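/- Let q be complex with |q| < 1 and a a complex number with a q^m != 1 for every integer m >= 1. Then sum_{j,k >= 0} a^{2j+k} q^{j(2j+2k+1) + k^2} [k+j-1 choose j]_q / ((aq;q)_{2j+2k} (q;q)_k) = (aq;q)_inf^{-1} sum_{i >= 0} a^{2i} q^{C(2i+1,2)} / (q;q)_i, where [n+j choose j]_q = (q^{n+1};q)_j / (q;q)_j for integers j >= 0 and arbitrary integer n (so in particular [k+j-1 choose j]_q = (q^k;q)_j/(q;q)_j). -/

import Mathlib

open scoped BigOperators

noncomputable section

/-- Finite q-Pochhammer symbol `(a;q)_n`. -/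
def qP (q a : ℂ) (n : ℕ) : ℂ := ∏ m ∈ Finset.range n, (1 - a * q ^ m)

/-- Infinite q-Pochhammer symbol `(a;q)_∞`. -/
def qPInf (q a : ℂ) : ℂ := ∏' m : ℕ, (1 - a * q ^ m)

/-- The q-binomial coefficient `[n+j choose j]_q = (q^{n+1};q)_j / (q;q)_j`
for `j : ℕ` and arbitrary `n : ℤ`. -/
def qBinTop (q : ℂ) (n : ℤ) (j : ℕ) : ℂ := qP q (q ^ (n + 1)) j / qP q q j

open Finset Filter Topology

lemma qP_zero (q x : ℂ) : qP q x 0 = 1 := by simp [qP]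

lemma qP_succ (q x : ℂ) (n : ℕ) : qP q x (n + 1) = qP q x n * (1 - x * q ^ n) := by
  simp [qP, prod_range_succ]

lemma qP_succ' (q x : ℂ) (n : ℕ) : qP q x (n + 1) = (1 - x) * qP q (x * q) n := by
  simp only [qP, prod_range_succ']
  rw [mul_comm]
  congr 1
  · simp
  · apply prod_congr rfl
    intro m _
    ring

lemma qP_add (q x : ℂ) (n k : ℕ) : qP q x (n + k) = qP q x n * qP q (x * q ^ n) k := by
  simp only [qP, prod_range_add]
  congr 1
  apply prod_congr rfl
  intro m _
  ring

lemma pow_ne_one_of_norm {q : ℂ} (hq : ‖q‖ < 1) (n : ℕ) : 1 - q ^ (n + 1) ≠ 0 := by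
  intro h
  have h1 : ‖q ^ (n + 1)‖ = 1 := by
    rw [← sub_eq_zero.mp h]; simp
  rw [norm_pow] at h1
  have := pow_lt_one₀ (norm_nonneg q) hq (Nat.succ_ne_zero n)
  exact absurd h1 this.ne

lemma qP_self_ne {q : ℂ} (hq : ‖q‖ < 1) (n : ℕ) : qP q q n ≠ 0 := by
  rw [qP, prod_ne_zero_iff]
  intro m _
  have := pow_ne_one_of_norm hq m
  rwa [pow_succ'] at this

lemma inv_succ {q : ℂ} (hq : ‖q‖ < 1) (n : ℕ) :
    (1 - q ^ (n + 1)) * (qP q q (n + 1))⁻¹ = (qP q q n)⁻¹ := by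
  rw [qP_succ, ← pow_succ', mul_inv]
  field_simp [pow_ne_one_of_norm hq n, qP_self_ne hq n]

/-- Pascal-type recursion. -/
lemma pascal {q : ℂ} (hq : ‖q‖ < 1) (n : ℕ) (f : ℕ → ℕ → ℂ) :
    (1 - q ^ (n + 1)) * ∑ p ∈ antidiagonal (n + 1),
        (qP q q p.1)⁻¹ * (qP q q p.2)⁻¹ * f p.1 p.2
      = ∑ p ∈ antidiagonal n, (qP q q p.1)⁻¹ * (qP q q p.2)⁻¹ *
          (f (p.1 + 1) p.2 + q ^ p.1 * f p.1 (p.2 + 1)) := by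
  have h : (1 - q ^ (n + 1)) * ∑ p ∈ antidiagonal (n + 1),
        (qP q q p.1)⁻¹ * (qP q q p.2)⁻¹ * f p.1 p.2
      = ∑ p ∈ antidiagonal (n + 1),
          ((1 - q ^ p.1) * (qP q q p.1)⁻¹) * (qP q q p.2)⁻¹ * f p.1 p.2
        + ∑ p ∈ antidiagonal (n + 1), q ^ p.1 *
          ((qP q q p.1)⁻¹ * ((1 - q ^ p.2) * (qP q q p.2)⁻¹) * f p.1 p.2) := by
    rw [mul_sum, ← sum_add_distrib]
    apply sum_congr rfl
    intro p hp
    rw [← mem_antidiagonal.mp hp, pow_add]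
    ring
  rw [h, Nat.sum_antidiagonal_succ, Nat.sum_antidiagonal_succ']
  simp only [pow_zero, sub_self, zero_mul, mul_zero, zero_add, inv_succ hq]
  rw [← sum_add_distrib]
  apply sum_congr rfl
  intro p _
  ring

/-- finite q-binomial theorem -/
lemma qbinom {q : ℂ} (hq : ‖q‖ < 1) (n : ℕ) (x : ℂ) :
    ∑ p ∈ antidiagonal n, (qP q q p.1)⁻¹ * (qP q q p.2)⁻¹ *
      ((-1) ^ p.1 * q ^ (p.1.choose 2) * x ^ p.1) = qP q x n * (qP q q n)⁻¹ := by
  induction n generalizing x with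
  | zero => simp [qP_zero]
  | succ n ih =>
    apply mul_left_cancel₀ (pow_ne_one_of_norm hq n)
    rw [pascal hq n (fun s _ => (-1) ^ s * q ^ (s.choose 2) * x ^ s), mul_left_comm, inv_succ hq,
      qP_succ', mul_assoc, ← ih, mul_sum]
    apply sum_congr rfl
    intro p _
    have : (p.1 + 1).choose 2 = p.1 + p.1.choose 2 := by
      rw [Nat.choose_succ_succ' p.1 1]; simp
    rw [this]
    ring

/-- finite Cauchy identity -/
lemma cauchy_fin {q : ℂ} (hq : ‖q‖ < 1) (n : ℕ) (b : ℂ) :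
    ∑ p ∈ antidiagonal n, (qP q q p.1)⁻¹ * (qP q q p.2)⁻¹ *
      (b ^ p.1 * q ^ (p.1 ^ 2) * qP q (b * q ^ (p.1 + 1)) p.2) = (qP q q n)⁻¹ := by
  induction n generalizing b with
  | zero => simp [qP_zero]
  | succ n ih =>
    apply mul_left_cancel₀ (pow_ne_one_of_norm hq n)
    rw [pascal hq n (fun s t => b ^ s * q ^ (s ^ 2) * qP q (b * q ^ (s + 1)) t), inv_succ hq,
      ← ih (b * q)]
    apply sum_congr rfl
    intro p _
    rw [qP_succ', show b * q ^ (p.1 + 1) * q = b * q ^ (p.1 + 1 + 1) by ring,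
      show b * q * q ^ (p.1 + 1) = b * q ^ (p.1 + 1 + 1) by ring]
    ring

lemma triple (n : ℕ) (f : ℕ → ℕ → ℕ → ℂ) :
    ∑ p ∈ antidiagonal n, ∑ s ∈ antidiagonal p.2, f p.1 s.1 s.2
      = ∑ p ∈ antidiagonal n, ∑ s ∈ antidiagonal p.1, f s.2 s.1 p.2 := by
  rw [sum_sigma', sum_sigma']
  refine sum_nbij' (fun x => ⟨(x.1.1 + x.2.1, x.2.2), (x.2.1, x.1.1)⟩)
    (fun x => ⟨(x.2.2, x.2.1 + x.1.2), (x.2.1, x.1.2)⟩) ?_ ?_ ?_ ?_ ?_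
  · rintro ⟨⟨a, b⟩, ⟨c, d⟩⟩ h
    simp only [mem_sigma, HasAntidiagonal.mem_antidiagonal] at h
    refine mem_sigma.mpr ⟨HasAntidiagonal.mem_antidiagonal.mpr ?_,
      HasAntidiagonal.mem_antidiagonal.mpr ?_⟩ <;> dsimp only <;> omega
  · rintro ⟨⟨a, b⟩, ⟨c, d⟩⟩ h
    simp only [mem_sigma, HasAntidiagonal.mem_antidiagonal] at h
    refine mem_sigma.mpr ⟨HasAntidiagonal.mem_antidiagonal.mpr ?_,
      HasAntidiagonal.mem_antidiagonal.mpr ?_⟩ <;> dsimp only <;> omega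
  · rintro ⟨⟨a, b⟩, ⟨c, d⟩⟩ h
    simp only [mem_sigma, HasAntidiagonal.mem_antidiagonal] at h ⊢
    obtain ⟨h1, rfl⟩ := h
    rfl
  · rintro ⟨⟨a, b⟩, ⟨c, d⟩⟩ h
    simp only [mem_sigma, HasAntidiagonal.mem_antidiagonal] at h ⊢
    obtain ⟨h1, rfl⟩ := h
    rw [add_comm c d]
  · rintro ⟨⟨a, b⟩, ⟨c, d⟩⟩ h
    rfl

lemma beta_fin {q : ℂ} (hq : ‖q‖ < 1) (N : ℕ) (a : ℂ) :
    ∑ p ∈ antidiagonal N, a ^ p.1 * q ^ (p.1 ^ 2 + p.1) * (qP q q p.1)⁻¹ *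
        (qP q (a * q ^ (N + p.1 + 1)) p.2 * (qP q q p.2)⁻¹)
      = ∑ p ∈ antidiagonal N, a ^ p.1 * q ^ (p.1 ^ 2 + p.1) * (qP q q p.2)⁻¹ *
        (qP q (q ^ p.2) p.1 * (qP q q p.1)⁻¹) := by
  simp only [← qbinom hq, mul_sum]
  rw [triple N (fun r s u => a ^ r * q ^ (r ^ 2 + r) * (qP q q r)⁻¹ *
    ((qP q q s)⁻¹ * (qP q q u)⁻¹ *
      ((-1) ^ s * q ^ (s.choose 2) * (a * q ^ (N + r + 1)) ^ s)))]
  apply sum_congr rfl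
  rintro ⟨j, u⟩ hp
  apply sum_congr rfl
  rintro ⟨s, r⟩ hs
  simp only [HasAntidiagonal.mem_antidiagonal] at hp hs
  subst hs
  subst hp
  have e : a ^ r * q ^ (r ^ 2 + r) * (a * q ^ (s + r + u + r + 1)) ^ s
      = a ^ (s + r) * q ^ ((s + r) ^ 2 + (s + r)) * (q ^ u) ^ s := by
    ring
  linear_combination ((qP q q s)⁻¹ * (qP q q r)⁻¹ * (qP q q u)⁻¹ * (-1) ^ s * q ^ (s.choose 2)) * e

/-! Analytic part -/

lemma summable_xq {q : ℂ} (hq : ‖q‖ < 1) (x : ℂ) : Summable (fun m : ℕ => ‖-(x * q ^ m)‖) := by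
  simp only [norm_neg, norm_mul, norm_pow]
  exact (summable_geometric_of_lt_one (norm_nonneg q) hq).mul_left _

lemma tendsto_qP {q : ℂ} (hq : ‖q‖ < 1) (x : ℂ) :
    Tendsto (qP q x) atTop (𝓝 (qPInf q x)) := by
  have h := (multipliable_one_add_of_summable (summable_xq hq x)).tendsto_prod_tprod_nat
  simp only [← sub_eq_add_neg] at h
  exact h

lemma qPInf_ne {q : ℂ} (hq : ‖q‖ < 1) (x : ℂ) (hx : ∀ m : ℕ, x * q ^ m ≠ 1) :
    qPInf q x ≠ 0 := by
  have h := tprod_one_add_ne_zero_of_summable (f := fun m : ℕ => -(x * q ^ m))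
    (fun i => by rw [← sub_eq_add_neg]; exact sub_ne_zero.mpr (hx i).symm) (summable_xq hq x)
  simp only [← sub_eq_add_neg] at h
  exact h

lemma qP_ne {q : ℂ} (x : ℂ) (hx : ∀ m : ℕ, x * q ^ m ≠ 1) (n : ℕ) : qP q x n ≠ 0 := by
  rw [qP, prod_ne_zero_iff]
  intro m _
  exact sub_ne_zero.mpr (hx m).symm

lemma qPInf_add {q : ℂ} (hq : ‖q‖ < 1) (x : ℂ) (n : ℕ) :
    qPInf q x = qP q x n * qPInf q (x * q ^ n) := by
  have h1 : Tendsto (fun k => qP q x (k + n)) atTop (𝓝 (qPInf q x)) :=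
    (tendsto_add_atTop_iff_nat n).mpr (tendsto_qP hq x)
  have h2 := (tendsto_qP hq (x * q ^ n)).const_mul (qP q x n)
  refine tendsto_nhds_unique h1 (h2.congr fun k => ?_)
  rw [add_comm k n, qP_add]

lemma inv_bound {q : ℂ} (hq : ‖q‖ < 1) (x : ℂ) (hx : ∀ m : ℕ, x * q ^ m ≠ 1) :
    ∃ C : ℝ, 0 ≤ C ∧ ∀ n, ‖(qP q x n)⁻¹‖ ≤ C := by
  have h := (tendsto_qP hq x).inv₀ (qPInf_ne hq x hx)
  obtain ⟨C, hC⟩ := (Metric.isBounded_range_of_tendsto _ h).exists_norm_le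
  have hC' : ∀ n, ‖(qP q x n)⁻¹‖ ≤ C := fun n => hC _ ⟨n, rfl⟩
  exact ⟨C, (norm_nonneg _).trans (hC' 0), hC'⟩

lemma self_ne {q : ℂ} (hq : ‖q‖ < 1) (m : ℕ) : q * q ^ m ≠ 1 := by
  have := pow_ne_one_of_norm hq m
  rw [pow_succ'] at this
  exact (sub_ne_zero.mp this).symm

lemma qpow_bound {q : ℂ} (hq : ‖q‖ < 1) (k j : ℕ) :
    ‖qP q (q ^ k) j‖ ≤ Real.exp (∑' m : ℕ, ‖q‖ ^ m) := by
  have hs := summable_geometric_of_lt_one (norm_nonneg q) hq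
  calc ‖qP q (q ^ k) j‖ = ∏ m ∈ range j, ‖1 - q ^ k * q ^ m‖ := by rw [qP, norm_prod]
    _ ≤ ∏ m ∈ range j, Real.exp (‖q‖ ^ m) := by
        apply Finset.prod_le_prod
        · intros; positivity
        · intro m _
          have h1 : ‖1 - q ^ k * q ^ m‖ ≤ 1 + ‖q‖ ^ k * ‖q‖ ^ m := by
            refine (norm_sub_le _ _).trans ?_
            simp
          have h2 : ‖q‖ ^ k * ‖q‖ ^ m ≤ ‖q‖ ^ m :=
            mul_le_of_le_one_left (by positivity) (pow_le_one₀ (norm_nonneg q) hq.le)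
          have h3 := Real.add_one_le_exp (‖q‖ ^ m)
          linarith
    _ = Real.exp (∑ m ∈ range j, ‖q‖ ^ m) := by rw [Real.exp_sum]
    _ ≤ _ := Real.exp_le_exp.mpr (hs.sum_le_tsum _ (fun _ _ => by positivity))

lemma summable_gauss {A Q : ℝ} (hA : 0 ≤ A) (hQ : 0 ≤ Q) (hQ1 : Q < 1) :
    Summable (fun n : ℕ => A ^ n * Q ^ (n ^ 2)) := by
  have ht : Tendsto (fun n : ℕ => A * Q ^ n) atTop (𝓝 (A * 0)) :=
    (tendsto_pow_atTop_nhds_zero_of_lt_one hQ hQ1).const_mul A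
  rw [mul_zero] at ht
  have hev : ∀ᶠ n : ℕ in atTop, A * Q ^ n ≤ 1 / 2 :=
    ht.eventually (eventually_le_nhds (by norm_num))
  refine Summable.of_norm_bounded_eventually_nat (g := fun n : ℕ => (1 / 2 : ℝ) ^ n)
    (summable_geometric_of_lt_one (by norm_num) (by norm_num)) ?_
  filter_upwards [hev] with n hn
  rw [Real.norm_of_nonneg (by positivity), sq, pow_mul, ← mul_pow]
  exact pow_le_pow_left₀ (by positivity) hn n

/-- Cauchy's identity -/
lemma cauchy_inf {q : ℂ} (hq : ‖q‖ < 1) (b : ℂ) (hb : ∀ m : ℕ, (b * q) * q ^ m ≠ 1) :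
    ∑' m : ℕ, (qP q q m)⁻¹ * (b ^ m * q ^ (m ^ 2) * (qP q (b * q) m)⁻¹)
      = (qPInf q (b * q))⁻¹ := by
  obtain ⟨C, hC0, hC⟩ := inv_bound hq q (self_ne hq)
  obtain ⟨D, hD0, hD⟩ := inv_bound hq (b * q) hb
  have hinf := qPInf_ne hq q (self_ne hq)
  have hfin : ∀ n : ℕ, ∑' m : ℕ, (if m ≤ n then (qP q q m)⁻¹ * (qP q q (n - m))⁻¹ *
      (b ^ m * q ^ (m ^ 2) * (qP q (b * q) m)⁻¹) else 0)
      = (qP q q n)⁻¹ * (qP q (b * q) n)⁻¹ := by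
    intro n
    rw [← cauchy_fin hq n b, tsum_eq_sum (s := range (n + 1)), sum_mul,
      Nat.sum_antidiagonal_eq_sum_range_succ_mk]
    · apply sum_congr rfl
      intro m hm
      have hm' : m ≤ n := by simp at hm; omega
      rw [if_pos hm']
      have h := qP_add q (b * q) m (n - m)
      rw [Nat.add_sub_cancel' hm', show b * q * q ^ m = b * q ^ (m + 1) by ring] at h
      have h1 := qP_ne (b * q) hb n
      have h2 := qP_ne (b * q) hb m
      have h3 : (qP q (b * q) m)⁻¹ = qP q (b * q ^ (m + 1)) (n - m) * (qP q (b * q) n)⁻¹ := by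
        field_simp
        rw [h]
      simp only
      rw [h3]
      ring
    · intro m hm
      rw [if_neg]
      simp at hm
      omega
  have ht : Tendsto (fun n : ℕ => ∑' m : ℕ, (if m ≤ n then (qP q q m)⁻¹ * (qP q q (n - m))⁻¹ *
      (b ^ m * q ^ (m ^ 2) * (qP q (b * q) m)⁻¹) else 0)) atTop
      (𝓝 (∑' m : ℕ, (qP q q m)⁻¹ * (qPInf q q)⁻¹ *
        (b ^ m * q ^ (m ^ 2) * (qP q (b * q) m)⁻¹))) := by
    apply tendsto_tsum_of_dominated_convergence
      (bound := fun m => C * C * D * (‖b‖ ^ m * ‖q‖ ^ (m ^ 2)))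
    · exact (summable_gauss (norm_nonneg b) (norm_nonneg q) hq).mul_left _
    · intro m
      have h1 : Tendsto (fun n : ℕ => (qP q q (n - m))⁻¹) atTop (𝓝 (qPInf q q)⁻¹) :=
        ((tendsto_qP hq q).inv₀ hinf).comp (tendsto_sub_atTop_nat m)
      have h2 := (h1.const_mul ((qP q q m)⁻¹)).mul_const
        (b ^ m * q ^ (m ^ 2) * (qP q (b * q) m)⁻¹)
      refine h2.congr' ?_
      filter_upwards [eventually_ge_atTop m] with n hn
      rw [if_pos hn]
    · refine Eventually.of_forall fun n m => ?_
      split_ifs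
      · rw [norm_mul, norm_mul, norm_mul, norm_mul, norm_pow, norm_pow]
        calc _ ≤ C * C * (‖b‖ ^ m * ‖q‖ ^ (m ^ 2) * D) := by
              gcongr
              · exact hC _
              · exact hC _
              · exact hD _
          _ = _ := by ring
      · rw [norm_zero]; positivity
  simp only [hfin] at ht
  have ht2 := ((tendsto_qP hq q).inv₀ hinf).mul ((tendsto_qP hq (b * q)).inv₀ (qPInf_ne hq _ hb))
  have h := tendsto_nhds_unique ht ht2
  have h' : (qPInf q q)⁻¹ * ∑' m : ℕ, (qP q q m)⁻¹ * (b ^ m * q ^ (m ^ 2) * (qP q (b * q) m)⁻¹)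
      = (qPInf q q)⁻¹ * (qPInf q (b * q))⁻¹ := by
    rw [← h, ← tsum_mul_left]
    congr 1
    ext m
    ring
  exact mul_left_cancel₀ (inv_ne_zero hinf) h'

lemma tsum_antidiag (f : ℕ × ℕ → ℂ) (hf : Summable f) :
    ∑' x, f x = ∑' n : ℕ, ∑ p ∈ antidiagonal n, f p := by
  conv_rhs => congr; ext; rw [← Finset.sum_finset_coe, ← tsum_fintype (L := .unconditional _)]
  rw [← HasAntidiagonal.sigmaAntidiagonalEquivProd.tsum_eq f]
  exact ((HasAntidiagonal.sigmaAntidiagonalEquivProd (A := ℕ)).summable_iff.mpr hf).tsum_sigma'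
    (fun n => (hasSum_fintype _).summable)

lemma summable_bd {q : ℂ} (hq : ‖q‖ < 1) (a : ℂ) (K : ℝ) :
    Summable (fun x : ℕ × ℕ => K * (((‖a‖ ^ 2) ^ x.1 * (‖q‖ ^ 2) ^ (x.1 ^ 2)) *
      (‖a‖ ^ x.2 * ‖q‖ ^ (x.2 ^ 2)))) := by
  apply Summable.mul_left
  apply Summable.mul_of_nonneg (f := fun n : ℕ => (‖a‖ ^ 2) ^ n * (‖q‖ ^ 2) ^ (n ^ 2))
    (g := fun n : ℕ => ‖a‖ ^ n * ‖q‖ ^ (n ^ 2))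
  · exact summable_gauss (by positivity) (by positivity)
      (pow_lt_one₀ (norm_nonneg q) hq (by norm_num))
  · exact summable_gauss (by positivity) (by positivity) hq
  · intro n; positivity
  · intro n; positivity

lemma exp_bd {q : ℂ} (hq : ‖q‖ < 1) (a : ℂ) (j k E : ℕ) (hE : 2 * j ^ 2 + k ^ 2 ≤ E) :
    ‖a ^ (2 * j + k) * q ^ E‖ ≤
      ((‖a‖ ^ 2) ^ j * (‖q‖ ^ 2) ^ (j ^ 2)) * (‖a‖ ^ k * ‖q‖ ^ (k ^ 2)) := by
  rw [norm_mul, norm_pow, norm_pow]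
  calc ‖a‖ ^ (2 * j + k) * ‖q‖ ^ E ≤ ‖a‖ ^ (2 * j + k) * ‖q‖ ^ (2 * j ^ 2 + k ^ 2) := by
        apply mul_le_mul_of_nonneg_left _ (by positivity)
        exact pow_le_pow_of_le_one (norm_nonneg q) hq.le hE
    _ = _ := by ring

/-- Identity (3.26) of the paper. -/
theorem een_identity (q a : ℂ) (hq : ‖q‖ < 1)
    (ha : ∀ m : ℕ, 1 ≤ m → a * q ^ m ≠ 1) :
    (∑' x : ℕ × ℕ,
      a ^ (2 * x.1 + x.2) * q ^ (x.1 * (2 * x.1 + 2 * x.2 + 1) + x.2 ^ 2) *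
        qBinTop q ((x.2 : ℤ) - 1) x.1 /
        (qP q (a * q) (2 * x.1 + 2 * x.2) * qP q q x.2))
    = (qPInf q (a * q))⁻¹ *
        ∑' i : ℕ, a ^ (2 * i) * q ^ (i * (2 * i + 1)) / qP q q i := by
  have hx : ∀ m : ℕ, (a * q) * q ^ m ≠ 1 := fun m => by
    rw [mul_assoc, ← pow_succ']; exact ha _ (by omega)
  obtain ⟨C, hC0, hC⟩ := inv_bound hq q (self_ne hq)
  obtain ⟨D, hD0, hD⟩ := inv_bound hq (a * q) hx
  set B := Real.exp (∑' m : ℕ, ‖q‖ ^ m) with hB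
  have hB0 : 0 ≤ B := (Real.exp_pos _).le
  set F : ℕ × ℕ → ℂ := fun x =>
    (a ^ (2 * x.1 + x.2) * q ^ (x.1 * (2 * x.1 + 2 * x.2 + 1) + x.2 ^ 2)) *
      (qP q (q ^ x.2) x.1 * (qP q q x.1)⁻¹ * (qP q (a * q) (2 * x.1 + 2 * x.2))⁻¹ *
        (qP q q x.2)⁻¹) with hF
  set G : ℕ × ℕ → ℂ := fun x =>
    (a ^ (2 * x.1 + x.2) * q ^ (x.1 ^ 2 + x.1 + (x.1 + x.2) ^ 2)) *
      ((qP q q x.1)⁻¹ * (qP q q x.2)⁻¹ * (qP q (a * q) (2 * x.1 + x.2))⁻¹) with hG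
  have hFs : Summable F := by
    refine Summable.of_norm_bounded (summable_bd hq a (B * C * D * C)) fun x => ?_
    rw [hF, mul_comm (B * C * D * C)]
    simp only
    rw [norm_mul]
    apply mul_le_mul (exp_bd hq a _ _ _ (by nlinarith)) _ (norm_nonneg _) (by positivity)
    simp only [norm_mul]
    gcongr
    · exact qpow_bound hq _ _
    · exact hC _
    · exact hD _
    · exact hC _
  have hGs : Summable G := by
    refine Summable.of_norm_bounded (summable_bd hq a (C * C * D)) fun x => ?_
    rw [hG, mul_comm (C * C * D)]
    simp only
    rw [norm_mul]
    apply mul_le_mul (exp_bd hq a _ _ _ (by ring_nf; nlinarith [Nat.zero_le (x.1 * x.2), Nat.zero_le x.1])) _ (norm_nonneg _) (by positivity)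
    simp only [norm_mul]
    gcongr
    · exact hC _
    · exact hC _
    · exact hD _
  have hL : ∀ x : ℕ × ℕ, a ^ (2 * x.1 + x.2) * q ^ (x.1 * (2 * x.1 + 2 * x.2 + 1) + x.2 ^ 2) *
        qBinTop q ((x.2 : ℤ) - 1) x.1 /
        (qP q (a * q) (2 * x.1 + 2 * x.2) * qP q q x.2) = F x := by
    intro x
    rw [hF, qBinTop, sub_add_cancel, zpow_natCast, div_eq_mul_inv, div_eq_mul_inv, mul_inv]
    ring
  simp only [hL]
  rw [tsum_antidiag F hFs]
  have hFG : ∀ N : ℕ, ∑ p ∈ antidiagonal N, F p = ∑ p ∈ antidiagonal N, G p := by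
    intro N
    have h1 : ∑ p ∈ antidiagonal N, F p = a ^ N * q ^ (N ^ 2) * (qP q (a * q) (2 * N))⁻¹ *
        ∑ p ∈ antidiagonal N, a ^ p.1 * q ^ (p.1 ^ 2 + p.1) * (qP q q p.2)⁻¹ *
        (qP q (q ^ p.2) p.1 * (qP q q p.1)⁻¹) := by
      rw [mul_sum]
      apply sum_congr rfl
      rintro ⟨j, k⟩ hp
      simp only [HasAntidiagonal.mem_antidiagonal] at hp
      subst hp
      simp only [hF]
      rw [show 2 * (j + k) = 2 * j + 2 * k by ring]
      ring
    have h2 : ∑ p ∈ antidiagonal N, G p = a ^ N * q ^ (N ^ 2) * (qP q (a * q) (2 * N))⁻¹ *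
        ∑ p ∈ antidiagonal N, a ^ p.1 * q ^ (p.1 ^ 2 + p.1) * (qP q q p.1)⁻¹ *
        (qP q (a * q ^ (N + p.1 + 1)) p.2 * (qP q q p.2)⁻¹) := by
      rw [mul_sum]
      apply sum_congr rfl
      rintro ⟨r, m⟩ hp
      simp only [HasAntidiagonal.mem_antidiagonal] at hp
      subst hp
      simp only [hG]
      have h := qP_add q (a * q) (2 * r + m) m
      rw [show a * q * q ^ (2 * r + m) = a * q ^ (r + m + r + 1) by ring,
        show 2 * r + m + m = 2 * (r + m) by ring] at h
      have n1 := qP_ne (a * q) hx (2 * (r + m))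
      have n2 := qP_ne (a * q) hx (2 * r + m)
      have h3 : (qP q (a * q) (2 * r + m))⁻¹ = qP q (a * q ^ (r + m + r + 1)) m *
          (qP q (a * q) (2 * (r + m)))⁻¹ := by
        field_simp
        rw [h]
      rw [h3]
      ring
    rw [h1, h2, beta_fin hq]
  simp only [hFG]
  rw [← tsum_antidiag G hGs, hGs.tsum_prod, ← tsum_mul_left]
  congr 1
  ext r
  have hb : ∀ m : ℕ, (a * q ^ (2 * r) * q) * q ^ m ≠ 1 := fun m => by
    rw [show (a * q ^ (2 * r) * q) * q ^ m = a * q * q ^ (2 * r + m) by ring]; exact hx _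
  have hc := cauchy_inf hq (a * q ^ (2 * r)) hb
  have hshift := qPInf_add hq (a * q) (2 * r)
  rw [show a * q * q ^ (2 * r) = a * q ^ (2 * r) * q by ring] at hshift
  rw [hshift, mul_inv, ← hc, div_eq_mul_inv, mul_assoc, ← tsum_mul_right, ← tsum_mul_left]
  congr 1
  ext m
  have h := qP_add q (a * q) (2 * r) m
  rw [show a * q * q ^ (2 * r) = a * q ^ (2 * r) * q by ring] at h
  simp only [hG]
  rw [h, mul_inv]
  ring
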